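/- F-transform characterization of compactly supported centered measures: a Borel probability measure μ on ℝ has compact support, mean 0 and variance σ² (where σ ≥ 0) if and only if there exists a finite nonnegative compactly supported Borel measure τ on ℝ with τ(ℝ) = σ² such that F_μ(z) = z + ∫_ℝ 1/(x−z) dτ(x) for all z ∈ ℍ. -/

import Mathlib

open MeasureTheory Filter Topology Set

/-- The Cauchy transform of a measure on ℝ, `G_μ(z) = ∫ 1/(z-x) dμ(x)`. -/
noncomputable def cauchyTransform (μ : Measure ℝ) (z : ℂ) : ℂ :=
  ∫ x, (z - (x : ℂ))⁻¹ ∂μ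

/-- The F-transform of a measure on ℝ, `F_μ(z) = 1/G_μ(z)`. -/
noncomputable def Ftransform (μ : Measure ℝ) (z : ℂ) : ℂ :=
  (cauchyTransform μ z)⁻¹

theorem sub_ofReal_ne_zero {z : ℂ} (hz : 0 < z.im) (x : ℝ) : z - (x : ℂ) ≠ 0 := fun h ↦ by
  have := congrArg Complex.im h
  simp only [Complex.sub_im, Complex.ofReal_im, sub_zero, Complex.zero_im] at this
  exact hz.ne' this

section Spectral

variable {H : Type*} [NormedAddCommGroup H] [InnerProductSpace ℂ H] [CompleteSpace H]

open CompactlySupported in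
/-- The spectral measure of a bounded self-adjoint operator `T` at a vector `v`, as a
measure on the spectrum of `T`. -/
theorem exists_measure_integral_eq_inner_cfcHom {T : H →L[ℂ] H} (hT : IsSelfAdjoint T) (v : H) :
    ∃ ν : Measure (spectrum ℝ T), IsFiniteMeasure ν ∧
      ∀ f : C(spectrum ℝ T, ℝ), ((∫ x, f x ∂ν : ℝ) : ℂ) = inner ℂ v (cfcHom hT f v) := by
  have hsym (f : C(spectrum ℝ T, ℝ)) :
      (((inner ℂ v (cfcHom hT f v) : ℂ).re : ℝ) : ℂ) = inner ℂ v (cfcHom hT f v) := by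
    have hA : IsSelfAdjoint (cfcHom hT f) := cfcHom_predicate hT f
    have := hA.isSymmetric v v
    rw [← Complex.conj_eq_iff_re, inner_conj_symm]
    exact this
  let φ : C(spectrum ℝ T, ℝ) →ₗ[ℝ] ℝ :=
    { toFun := fun f ↦ (inner ℂ v (cfcHom hT f v) : ℂ).re
      map_add' := fun f g ↦ by simp
      map_smul' := fun c f ↦ by
        have : (c • cfcHom hT f) v = (c : ℂ) • (cfcHom hT f v) := by simp
        rw [map_smul, this, inner_smul_right]
        simp }
  let Λ : C_c(spectrum ℝ T, ℝ) →ₚ[ℝ] ℝ := PositiveLinearMap.mk₀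
    { toFun := fun f ↦ φ f.toContinuousMap
      map_add' := fun f g ↦ φ.map_add _ _
      map_smul' := fun c f ↦ φ.map_smul c _ } (by
      intro f hf
      have hf' : (0 : C(spectrum ℝ T, ℝ)) ≤ f.toContinuousMap := fun x ↦ hf x
      have := (ContinuousLinearMap.nonneg_iff_isPositive _).1 ((cfcHom_nonneg_iff hT).2 hf')
      exact this.re_inner_nonneg_right v)
  refine ⟨RealRMK.rieszMeasure Λ, inferInstance, fun f ↦ ?_⟩
  rw [← hsym f]
  congr 1
  exact RealRMK.integral_rieszMeasure Λ ⟨f, HasCompactSupport.of_compactSpace _⟩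

/-- The resolvent of a self-adjoint operator, as a matrix coefficient, is the Cauchy transform of
a compactly supported measure. -/
theorem exists_measure_inner_resolvent_eq_cauchyTransform {T : H →L[ℂ] H}
    (hT : IsSelfAdjoint T) (v : H) :
    ∃ τ : Measure ℝ, IsFiniteMeasure τ ∧ (∃ K : Set ℝ, IsCompact K ∧ τ Kᶜ = 0) ∧
      (τ univ).toReal = ‖v‖ ^ 2 ∧
      ∀ z : ℂ, 0 < z.im → ∃ u : H, z • u - T u = v ∧ inner ℂ v u = cauchyTransform τ z := by
  obtain ⟨ν, hν, hνint⟩ := exists_measure_integral_eq_inner_cfcHom hT v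
  have hK : IsCompact (spectrum ℝ T) := spectrum.isCompact T
  refine ⟨ν.map Subtype.val, inferInstance, ⟨spectrum ℝ T, hK, ?_⟩, ?_, fun z hz ↦ ?_⟩
  · rw [Measure.map_apply (by fun_prop) hK.measurableSet.compl]
    simp
  · rw [Measure.map_apply (by fun_prop) MeasurableSet.univ]
    have h : ∫ x, (1 : C(spectrum ℝ T, ℝ)) x ∂ν = ‖v‖ ^ 2 := by
      apply Complex.ofReal_injective
      rw [hνint 1]
      simp [inner_self_eq_norm_sq_to_K]
    simpa [Measure.real] using h
  · have hcont : Continuous fun x : spectrum ℝ T ↦ (z - ((x : ℝ) : ℂ))⁻¹ :=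
      Continuous.inv₀ (by fun_prop) fun x ↦ sub_ofReal_ne_zero hz x
    let p : C(spectrum ℝ T, ℝ) := ⟨fun x ↦ ((z - ((x : ℝ) : ℂ))⁻¹).re,
      Complex.continuous_re.comp hcont⟩
    let q : C(spectrum ℝ T, ℝ) := ⟨fun x ↦ ((z - ((x : ℝ) : ℂ))⁻¹).im,
      Complex.continuous_im.comp hcont⟩
    let x : C(spectrum ℝ T, ℝ) := (ContinuousMap.id ℝ).restrict (spectrum ℝ T)
    have hmul (t : ℝ) : (z - (t : ℂ)) * (z - (t : ℂ))⁻¹ = 1 :=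
      mul_inv_cancel₀ (sub_ofReal_ne_zero hz t)
    have hre : z.re • p - z.im • q - x * p = 1 := by
      ext t
      have := congrArg Complex.re (hmul t)
      simp only [Complex.mul_re, Complex.sub_re, Complex.sub_im, Complex.ofReal_re,
        Complex.ofReal_im, Complex.one_re] at this
      simp only [ContinuousMap.sub_apply, ContinuousMap.smul_apply, ContinuousMap.mul_apply,
        ContinuousMap.one_apply, smul_eq_mul, p, q, x, ContinuousMap.coe_mk,
        ContinuousMap.restrict_apply, ContinuousMap.id_apply]
      linarith
    have him : z.re • q + z.im • p - x * q = 0 := by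
      ext t
      have := congrArg Complex.im (hmul t)
      simp only [Complex.mul_im, Complex.sub_re, Complex.sub_im, Complex.ofReal_re,
        Complex.ofReal_im, Complex.one_im] at this
      simp only [ContinuousMap.sub_apply, ContinuousMap.smul_apply, ContinuousMap.mul_apply,
        ContinuousMap.add_apply,
        ContinuousMap.zero_apply, smul_eq_mul, p, q, x, ContinuousMap.coe_mk,
        ContinuousMap.restrict_apply, ContinuousMap.id_apply]
      linarith
    have hx : cfcHom hT x = T := cfcHom_id hT
    have hsmul (c : ℝ) (A : H →L[ℂ] H) : (c • A) v = (c : ℂ) • A v := by simp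
    have hre' := congrArg (fun A ↦ A v) (congrArg (cfcHom hT) hre)
    have him' := congrArg (fun A ↦ A v) (congrArg (cfcHom hT) him)
    simp only [map_sub, map_add, map_smul, map_mul, map_one, map_zero, hx,
      _root_.sub_apply, _root_.add_apply, hsmul,
      mul_apply_eq_comp, one_apply_eq_self,
      _root_.zero_apply] at hre' him'
    refine ⟨cfcHom hT p v + Complex.I • cfcHom hT q v, ?_, ?_⟩
    · have hz' : z = z.re + z.im * Complex.I := (Complex.re_add_im z).symm
      rw [map_add, map_smul]
      calc z • (cfcHom hT p v + Complex.I • cfcHom hT q v) -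
            (T (cfcHom hT p v) + Complex.I • T (cfcHom hT q v))
          = ((z.re : ℂ) • cfcHom hT p v - (z.im : ℂ) • cfcHom hT q v - T (cfcHom hT p v)) +
            Complex.I • ((z.re : ℂ) • cfcHom hT q v + (z.im : ℂ) • cfcHom hT p v
              - T (cfcHom hT q v)) := by
            conv_lhs => rw [hz']
            linear_combination (norm := module) ((z.im : ℂ) * Complex.I_mul_I) • cfcHom hT q v
        _ = v := by rw [hre', him']; simp
    · rw [inner_add_right, inner_smul_right, ← hνint p, ← hνint q, cauchyTransform,
        integral_map (by fun_prop) (by fun_prop)]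
      have hint : Integrable (fun x : spectrum ℝ T ↦ (z - ((x : ℝ) : ℂ))⁻¹) ν :=
        hcont.integrable_of_hasCompactSupport (HasCompactSupport.of_compactSpace _)
      rw [mul_comm]
      exact integral_re_add_im hint

/-- **Schur complement formula**: compressing a self-adjoint operator to the orthogonal complement
of a unit vector `e` expresses the reciprocal of the resolvent coefficient at `e` through the
Cauchy transform of a spectral measure. -/
theorem exists_measure_schur_complement {M : H →L[ℂ] H} (hM : IsSelfAdjoint M) {e : H}
    (he : ‖e‖ = 1) :
    ∃ τ : Measure ℝ, IsFiniteMeasure τ ∧ (∃ K : Set ℝ, IsCompact K ∧ τ Kᶜ = 0) ∧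
      (τ univ).toReal = ‖M e - (inner ℂ e (M e) : ℂ) • e‖ ^ 2 ∧
      ∀ z : ℂ, 0 < z.im → ∃ w : H, inner ℂ e w = (1 : ℂ) ∧
        z • w - M w = (z - inner ℂ e (M e) - cauchyTransform τ z) • e := by
  let P : H →L[ℂ] H := (ℂ ∙ e)ᗮ.starProjection
  have hP : IsSelfAdjoint P := isSelfAdjoint_starProjection _
  have hPapply (f : H) : P f = f - (inner ℂ e f : ℂ) • e := by
    simp only [P, Submodule.starProjection_orthogonal']
    simp [Submodule.starProjection_unit_singleton ℂ he]
  have hee : inner ℂ e e = (1 : ℂ) := by simp [inner_self_eq_norm_sq_to_K, he]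
  have heP (f : H) : inner ℂ e (P f) = (0 : ℂ) := by
    rw [hPapply, inner_sub_right, inner_smul_right, hee]; ring
  have hT : IsSelfAdjoint (P * M * P) := by
    simpa [hP.star_eq] using hM.conjugate P
  obtain ⟨τ, hτ, hK, hmass, hres⟩ :=
    exists_measure_inner_resolvent_eq_cauchyTransform hT (P (M e))
  refine ⟨τ, hτ, hK, by rw [hmass, hPapply], fun z hz ↦ ?_⟩
  obtain ⟨u, hu, hu'⟩ := hres z hz
  have hz0 : z ≠ 0 := fun h ↦ by simp [h] at hz
  have heu : inner ℂ e u = (0 : ℂ) := by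
    have := congrArg (fun f ↦ (inner ℂ e f : ℂ)) hu
    simpa [inner_sub_right, inner_smul_right, heP, hz0] using this
  have hPu : P u = u := by rw [hPapply, heu]; simp
  have hMu : (inner ℂ e (M u) : ℂ) = cauchyTransform τ z := by
    have h1 : (inner ℂ (M e) u : ℂ) = inner ℂ e (M u) := hM.isSymmetric e u
    rw [← hu', hPapply, inner_sub_left, inner_smul_left, heu, h1]
    simp
  refine ⟨u + e, by rw [inner_add_right, heu, hee, zero_add], ?_⟩
  simp only [mul_apply_eq_comp, hPu] at hu
  rw [hPapply, hPapply, hMu, sub_eq_iff_eq_add] at hu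
  rw [smul_add, hu, map_add]
  module

end Spectral

theorem exists_ae_norm_le_of_compl_null {μ : Measure ℝ}
    (h : ∃ K : Set ℝ, IsCompact K ∧ μ Kᶜ = 0) : ∃ R : ℝ, 0 ≤ R ∧ ∀ᵐ x ∂μ, |x| ≤ R := by
  obtain ⟨K, hK, hμK⟩ := h
  obtain ⟨R, hR⟩ := hK.isBounded.exists_norm_le
  refine ⟨max R 0, le_max_right _ _, ?_⟩
  have hmem : ∀ᵐ x ∂μ, x ∈ K := hμK
  filter_upwards [hmem] with x hx using (hR x hx).trans (le_max_left _ _)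

/-- The F-transform of a compactly supported probability measure is, up to a shift by the mean,
the identity minus the Cauchy transform of a compactly supported measure whose mass is the
variance. -/
theorem exists_measure_Ftransform_eq (μ : Measure ℝ) [IsProbabilityMeasure μ]
    (hμ : ∃ K : Set ℝ, IsCompact K ∧ μ Kᶜ = 0) :
    ∃ τ : Measure ℝ, IsFiniteMeasure τ ∧ (∃ K : Set ℝ, IsCompact K ∧ τ Kᶜ = 0) ∧
      (τ univ).toReal = (∫ x, x ^ 2 ∂μ) - (∫ x, x ∂μ) ^ 2 ∧
      ∀ z : ℂ, 0 < z.im → Ftransform μ z = z - ((∫ x, x ∂μ : ℝ) : ℂ) - cauchyTransform τ z := by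
  obtain ⟨R, -, hR⟩ := exists_ae_norm_le_of_compl_null hμ
  have hXtop : MemLp (fun x : ℝ ↦ (x : ℂ)) ⊤ μ :=
    memLp_top_of_bound (by fun_prop) R (by simpa using hR)
  have hX : MemLp (fun x : ℝ ↦ x) 2 μ :=
    (memLp_top_of_bound (by fun_prop) R (by simpa using hR)).mono_exponent le_top
  let M : Lp ℂ 2 μ →L[ℂ] Lp ℂ 2 μ :=
    (ContinuousLinearMap.mul ℂ ℂ).holderL μ ⊤ 2 2 (hXtop.toLp _)
  have hMapply (f : Lp ℂ 2 μ) : M f =ᵐ[μ] fun x ↦ (x : ℂ) * f x := by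
    have h := ContinuousLinearMap.coeFn_holder (r := 2) (ContinuousLinearMap.mul ℂ ℂ)
      (hXtop.toLp _) f
    filter_upwards [h, hXtop.coeFn_toLp] with x hx hx'
    rw [← hx']
    exact hx
  have hM : IsSelfAdjoint M := by
    rw [ContinuousLinearMap.isSelfAdjoint_iff_isSymmetric]
    intro f g
    simp only [ContinuousLinearMap.coe_coe, L2.inner_def]
    refine integral_congr_ae ?_
    filter_upwards [hMapply f, hMapply g] with x hf hg
    simp only [hf, hg, RCLike.inner_apply, map_mul, Complex.conj_ofReal]
    ring
  let e : Lp ℂ 2 μ := (memLp_const (1 : ℂ)).toLp (fun _ : ℝ ↦ (1 : ℂ))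
  have he_ae : e =ᵐ[μ] fun _ ↦ (1 : ℂ) := MemLp.coeFn_toLp _
  have hinner (f : Lp ℂ 2 μ) : inner ℂ e f = ∫ x, f x ∂μ := by
    rw [L2.inner_def]
    refine integral_congr_ae ?_
    filter_upwards [he_ae] with x hx
    simp [hx]
  have hMe : M e =ᵐ[μ] fun x ↦ (x : ℂ) := by
    filter_upwards [hMapply e, he_ae] with x h1 h2
    rw [h1, h2, mul_one]
  have he : ‖e‖ = 1 := by
    have h : ((‖e‖ ^ 2 : ℝ) : ℂ) = 1 := by
      have h1 : (inner ℂ e e : ℂ) = 1 := by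
        rw [hinner, integral_congr_ae he_ae]; simp
      rw [← h1, inner_self_eq_norm_sq_to_K]
      simp
    have h' : ‖e‖ ^ 2 = 1 := by exact_mod_cast h
    exact (pow_eq_one_iff_of_nonneg (norm_nonneg e) two_ne_zero).1 h'
  have hmean : (inner ℂ e (M e) : ℂ) = ((∫ x, x ∂μ : ℝ) : ℂ) := by
    rw [hinner, integral_congr_ae hMe]
    exact integral_ofReal
  obtain ⟨τ, hτ, hK, hmass, hres⟩ := exists_measure_schur_complement hM he
  refine ⟨τ, hτ, hK, ?_, fun z hz ↦ ?_⟩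
  · have hvar : (∫ x, x ^ 2 ∂μ) - (∫ x, x ∂μ) ^ 2 = ∫ x, (x - ∫ y, y ∂μ) ^ 2 ∂μ := by
      have h1 := ProbabilityTheory.variance_eq_sub hX
      rw [ProbabilityTheory.variance_eq_integral hX.1.aemeasurable] at h1
      simpa using h1.symm
    rw [hmass, hvar, hmean]
    apply Complex.ofReal_injective
    have h1 := inner_self_eq_norm_sq_to_K (𝕜 := ℂ) (M e - ((∫ x, x ∂μ : ℝ) : ℂ) • e)
    rw [L2.inner_def] at h1
    push_cast
    refine h1.symm.trans ?_
    refine Eq.trans (integral_congr_ae ?_) integral_complex_ofReal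
    filter_upwards [Lp.coeFn_sub (M e) (((∫ x, x ∂μ : ℝ) : ℂ) • e),
      Lp.coeFn_smul ((∫ x, x ∂μ : ℝ) : ℂ) e, hMe, he_ae] with x h2 h3 h4 h5
    rw [h2, Pi.sub_apply, h3, Pi.smul_apply, h4, h5, RCLike.inner_apply]
    simp only [smul_eq_mul, mul_one, map_sub, Complex.conj_ofReal]
    push_cast
    ring
  · obtain ⟨w, hw1, hw2⟩ := hres z hz
    rw [hmean] at hw2
    set c := z - ((∫ x, x ∂μ : ℝ) : ℂ) - cauchyTransform τ z
    have hw : w =ᵐ[μ] fun x ↦ c * (z - (x : ℂ))⁻¹ := by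
      have h1 : (z • w - M w : Lp ℂ 2 μ) =ᵐ[μ] (c • e : Lp ℂ 2 μ) := by rw [hw2]
      filter_upwards [h1, Lp.coeFn_sub (z • w) (M w), Lp.coeFn_smul z w, Lp.coeFn_smul c e,
        hMapply w, he_ae] with x h1 h2 h3 h4 h5 h6
      rw [h2, h4, Pi.sub_apply, h3, Pi.smul_apply, Pi.smul_apply, h5, h6, smul_eq_mul,
        smul_eq_mul, mul_one, ← sub_mul] at h1
      rw [← h1]
      field_simp [sub_ofReal_ne_zero hz x]
    rw [hinner, integral_congr_ae hw, integral_const_mul] at hw1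
    exact inv_eq_of_mul_eq_one_left hw1

theorem integrable_inv_sub_ofReal (μ : Measure ℝ) [IsFiniteMeasure μ] {z : ℂ} (hz : 0 < z.im) :
    Integrable (fun x : ℝ ↦ (z - (x : ℂ))⁻¹) μ := by
  refine Integrable.of_bound (by fun_prop) z.im⁻¹ (.of_forall fun x ↦ ?_)
  rw [norm_inv]
  gcongr
  simpa using (le_abs_self _).trans (Complex.abs_im_le_norm (z - (x : ℂ)))

theorem im_cauchyTransform (μ : Measure ℝ) [IsFiniteMeasure μ] {z : ℂ} (hz : 0 < z.im) :
    (cauchyTransform μ z).im = ∫ x : ℝ, -(z.im / Complex.normSq (z - (x : ℂ))) ∂μ := by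
  have h : ∫ x : ℝ, ((z - (x : ℂ))⁻¹).im ∂μ = (∫ x : ℝ, (z - (x : ℂ))⁻¹ ∂μ).im :=
    integral_im (integrable_inv_sub_ofReal μ hz)
  rw [cauchyTransform, ← h]
  refine integral_congr_ae (.of_forall fun x ↦ ?_)
  simp [neg_div]

theorem measureReal_Icc_le_im_cauchyTransform (μ : Measure ℝ) [IsFiniteMeasure μ] {z : ℂ}
    (hz : 0 < z.im) :
    μ.real (Icc (z.re - z.im) (z.re + z.im)) ≤ 2 * z.im * -(cauchyTransform μ z).im := by
  have hint : Integrable (fun x : ℝ ↦ z.im / Complex.normSq (z - (x : ℂ))) μ := by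
    refine (integrable_inv_sub_ofReal μ hz).im.neg.congr (.of_forall fun x ↦ ?_)
    simp [neg_div]
  rw [im_cauchyTransform μ hz, integral_neg, neg_neg, ← integral_const_mul,
    ← integral_indicator_one measurableSet_Icc]
  refine integral_mono ((integrable_const 1).indicator measurableSet_Icc) (hint.const_mul _)
    fun x ↦ ?_
  have hpos : 0 < Complex.normSq (z - (x : ℂ)) := Complex.normSq_pos.2 (sub_ofReal_ne_zero hz x)
  by_cases hx : x ∈ Icc (z.re - z.im) (z.re + z.im)
  · rw [indicator_of_mem hx, Pi.one_apply, ← mul_div_assoc, le_div_iff₀ hpos, one_mul,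
      Complex.normSq_apply]
    simp only [Complex.sub_re, Complex.ofReal_re, Complex.sub_im, Complex.ofReal_im, sub_zero]
    nlinarith [hx.1, hx.2]
  · rw [indicator_of_notMem hx]
    positivity

/-- For a finite measure, `z G(z)` tends to the total mass along the imaginary axis. -/
theorem tendsto_mul_cauchyTransform (τ : Measure ℝ) [IsFiniteMeasure τ] :
    Tendsto (fun y : ℝ ↦ (y * Complex.I) * cauchyTransform τ (y * Complex.I)) atTop
      (𝓝 (((τ univ).toReal : ℝ) : ℂ)) := by
  have hlim : ∫ _ : ℝ, (1 : ℂ) ∂τ = (((τ univ).toReal : ℝ) : ℂ) := by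
    simp [Measure.real]
  rw [← hlim]
  simp only [cauchyTransform, ← integral_const_mul]
  refine tendsto_integral_filter_of_dominated_convergence (fun _ ↦ 1)
    (.of_forall fun y ↦ by fun_prop) ?_ (integrable_const 1) (.of_forall fun x ↦ ?_)
  · filter_upwards [eventually_gt_atTop 0] with y hy
    refine .of_forall fun x ↦ ?_
    have hle : ‖(y : ℂ) * Complex.I‖ ≤ ‖(y : ℂ) * Complex.I - x‖ := by
      have := Complex.abs_im_le_norm ((y : ℂ) * Complex.I - x)
      simpa using this
    rw [norm_mul, norm_inv, ← div_eq_mul_inv]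
    exact div_le_one_of_le₀ hle (norm_nonneg _)
  · have h0 : Tendsto (fun y : ℝ ↦ ((y⁻¹ : ℝ) : ℂ)) atTop (𝓝 0) := by
      exact_mod_cast (Complex.continuous_ofReal.tendsto 0).comp tendsto_inv_atTop_zero
    have h1 : Tendsto (fun y : ℝ ↦ (1 + (x : ℂ) * Complex.I * ((y⁻¹ : ℝ) : ℂ))⁻¹) atTop
        (𝓝 1) := by
      simpa using (tendsto_const_nhds.add (h0.const_mul ((x : ℂ) * Complex.I))).inv₀
        (by simp : (1 : ℂ) + (x : ℂ) * Complex.I * 0 ≠ 0)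
    refine h1.congr' ?_
    filter_upwards [eventually_gt_atTop 0] with y hy
    have hy' : (y : ℂ) ≠ 0 := by exact_mod_cast hy.ne'
    have hyI : (y : ℂ) * Complex.I ≠ 0 := mul_ne_zero hy' Complex.I_ne_zero
    have hfac : (y : ℂ) * Complex.I - x =
        (y : ℂ) * Complex.I * (1 + (x : ℂ) * Complex.I * ((y⁻¹ : ℝ) : ℂ)) := by
      push_cast
      field_simp
      linear_combination -(x : ℂ) * Complex.I_sq
    rw [hfac, mul_inv, mul_inv_cancel_left₀ hyI]

theorem tendsto_cauchyTransform (τ : Measure ℝ) [IsFiniteMeasure τ] :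
    Tendsto (fun y : ℝ ↦ cauchyTransform τ (y * Complex.I)) atTop (𝓝 0) := by
  have h0 : Tendsto (fun y : ℝ ↦ ((y⁻¹ : ℝ) : ℂ) * Complex.I⁻¹) atTop (𝓝 0) := by
    simpa using ((Complex.continuous_ofReal.tendsto 0).comp tendsto_inv_atTop_zero).mul_const
      Complex.I⁻¹
  have h1 := h0.mul (tendsto_mul_cauchyTransform τ)
  rw [zero_mul] at h1
  refine h1.congr' ?_
  filter_upwards [eventually_gt_atTop 0] with y hy
  have hy' : (y : ℂ) ≠ 0 := by exact_mod_cast hy.ne'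
  push_cast
  field_simp

/-- If the distribution function of a probability measure on `ℝ` has increments of quadratic order
outside a bounded interval, then the measure has compact support. -/
theorem exists_isCompact_of_measureReal_Icc_le (μ : Measure ℝ) [IsProbabilityMeasure μ]
    {C r : ℝ} (h : ∀ x y : ℝ, r < |x| → 0 < y → μ.real (Icc (x - y) (x + y)) ≤ C * y ^ 2) :
    ∃ K : Set ℝ, IsCompact K ∧ μ Kᶜ = 0 := by
  let g : ℝ → ℝ := fun x ↦ μ.real (Iic x)
  have hg : ⇑(ProbabilityTheory.cdf μ) = g := funext fun x ↦ ProbabilityTheory.cdf_eq_real μ x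
  have hdiff (a b : ℝ) (ha : r < |a|) : |g b - g a| ≤ C * ‖b - a‖ ^ 2 := by
    rcases eq_or_ne b a with rfl | hab
    · simp
    have hd : 0 < |b - a| := abs_pos.2 (sub_ne_zero.2 hab)
    have hI := h a |b - a| ha hd
    have h1 : g b ≤ g a + μ.real (Icc (a - |b - a|) (a + |b - a|)) := by
      refine (measureReal_mono fun t ht ↦ ?_).trans (measureReal_union_le _ _)
      by_cases hta : t ≤ a
      · exact Or.inl hta
      · refine Or.inr ⟨by linarith, ?_⟩
        have := le_abs_self (b - a)
        have : t ≤ b := ht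
        linarith
    have h2 : g a ≤ g b + μ.real (Icc (a - |b - a|) (a + |b - a|)) := by
      refine (measureReal_mono fun t ht ↦ ?_).trans (measureReal_union_le _ _)
      by_cases htb : t ≤ b
      · exact Or.inl htb
      · have := neg_abs_le (b - a)
        have : t ≤ a := ht
        exact Or.inr ⟨by linarith, by linarith⟩
    rw [Real.norm_eq_abs, abs_le]
    constructor <;> linarith
  have hderiv (a : ℝ) (ha : r < |a|) : HasDerivAt g 0 a := by
    rw [hasDerivAt_iff_isLittleO]
    refine Asymptotics.IsBigO.trans_isLittleO (Asymptotics.IsBigO.of_bound C ?_)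
      (Asymptotics.isLittleO_pow_sub_sub a one_lt_two)
    filter_upwards with b
    simpa using hdiff a b ha
  have hconst {s : Set ℝ} (hs : IsOpen s) (hs' : IsPreconnected s) (hsr : ∀ x ∈ s, r < |x|)
      {a b : ℝ} (ha : a ∈ s) (hb : b ∈ s) : g a = g b :=
    hs.is_const_of_deriv_eq_zero hs'
      (fun x hx ↦ (hderiv x (hsr x hx)).differentiableAt.differentiableWithinAt)
      (fun x hx ↦ (hderiv x (hsr x hx)).deriv) ha hb
  have htop : g (r + 1) = 1 := by
    refine tendsto_nhds_unique (tendsto_const_nhds.congr' ?_)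
      (hg ▸ ProbabilityTheory.tendsto_cdf_atTop μ)
    filter_upwards [eventually_gt_atTop r] with b hb
    exact hconst isOpen_Ioi isPreconnected_Ioi (fun x hx ↦ lt_of_lt_of_le hx (le_abs_self x))
      (by simp : r + 1 ∈ Ioi r) hb
  have hbot : g (-(r + 1)) = 0 := by
    refine tendsto_nhds_unique (tendsto_const_nhds.congr' ?_)
      (hg ▸ ProbabilityTheory.tendsto_cdf_atBot μ)
    filter_upwards [eventually_lt_atBot (-r)] with b hb
    exact hconst isOpen_Iio isPreconnected_Iio
      (fun x hx ↦ lt_of_lt_of_le (lt_neg.1 hx) (neg_le_abs x))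
      (by simp : -(r + 1) ∈ Iio (-r)) hb
  refine ⟨Icc (-(r + 1)) (r + 1), isCompact_Icc, ?_⟩
  have hsub : (Icc (-(r + 1)) (r + 1))ᶜ ⊆ Iic (-(r + 1)) ∪ (Iic (r + 1))ᶜ := by
    intro x hx
    by_contra hx'
    simp only [mem_union, mem_Iic, mem_compl_iff, not_or, not_le, not_lt] at hx'
    exact hx ⟨hx'.1.le, hx'.2⟩
  refine measure_mono_null hsub (measure_union_null ?_ ?_)
  · exact (measureReal_eq_zero_iff).1 hbot
  · exact (prob_compl_eq_zero_iff measurableSet_Iic).2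
      ((ENNReal.toReal_eq_one_iff _).1 htop)

theorem exists_isCompact_of_Ftransform_eq (μ τ : Measure ℝ) [IsProbabilityMeasure μ]
    [IsFiniteMeasure τ] (hτ : ∃ K : Set ℝ, IsCompact K ∧ τ Kᶜ = 0)
    (h : ∀ z : ℂ, 0 < z.im → Ftransform μ z = z - cauchyTransform τ z) :
    ∃ K : Set ℝ, IsCompact K ∧ μ Kᶜ = 0 := by
  obtain ⟨R, hR0, hR⟩ := exists_ae_norm_le_of_compl_null hτ
  refine exists_isCompact_of_measureReal_Icc_le μ (C := 2 * (1 + τ.real univ))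
    (r := R + τ.real univ + 1) fun x y hx hy ↦ ?_
  have hT : 0 ≤ τ.real univ := measureReal_nonneg
  set z : ℂ := ⟨x, y⟩
  have hz : 0 < z.im := hy
  have hdist : ∀ᵐ t : ℝ ∂τ, 1 ≤ ‖z - (t : ℂ)‖ := by
    filter_upwards [hR] with t ht
    have h1 : |x - t| ≤ ‖z - (t : ℂ)‖ := by simpa [z] using Complex.abs_re_le_norm (z - (t : ℂ))
    have h2 := abs_sub_abs_le_abs_sub x t
    linarith
  have hGnorm : ‖cauchyTransform τ z‖ ≤ τ.real univ := by
    have := norm_integral_le_of_norm_le_const (μ := τ) (f := fun t : ℝ ↦ (z - (t : ℂ))⁻¹) (C := 1)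
      (by filter_upwards [hdist] with t ht; rw [norm_inv]; exact inv_le_one_of_one_le₀ ht)
    simpa [cauchyTransform] using this
  have hGim : |(cauchyTransform τ z).im| ≤ y * τ.real univ := by
    rw [im_cauchyTransform τ hz, ← Real.norm_eq_abs]
    refine norm_integral_le_of_norm_le_const ?_
    filter_upwards [hdist] with t ht
    rw [norm_neg, Complex.normSq_eq_norm_sq, Real.norm_of_nonneg (by positivity)]
    exact div_le_self hy.le (one_le_pow₀ ht)
  have hF := h z hz
  have hFnorm : 1 ≤ ‖Ftransform μ z‖ := by
    have h1 : |x| ≤ ‖z‖ := Complex.abs_re_le_norm z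
    have h2 := norm_sub_norm_le z (cauchyTransform τ z)
    rw [hF]
    linarith
  have hFim : (Ftransform μ z).im ≤ y * (1 + τ.real univ) := by
    have h1 := neg_abs_le (cauchyTransform τ z).im
    rw [hF, Complex.sub_im]
    change y - _ ≤ _
    linarith
  have hGμ : -(cauchyTransform μ z).im ≤ y * (1 + τ.real univ) := by
    have h1 : cauchyTransform μ z = (Ftransform μ z)⁻¹ := by rw [Ftransform, inv_inv]
    have h2 : 1 ≤ ‖Ftransform μ z‖ ^ 2 := one_le_pow₀ hFnorm
    rw [h1, Complex.inv_im, neg_div, neg_neg, Complex.normSq_eq_norm_sq,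
      div_le_iff₀ (by positivity)]
    exact hFim.trans (le_mul_of_one_le_right (by positivity) h2)
  calc μ.real (Icc (x - y) (x + y)) ≤ 2 * y * -(cauchyTransform μ z).im :=
        measureReal_Icc_le_im_cauchyTransform μ hz
    _ ≤ 2 * y * (y * (1 + τ.real univ)) := by gcongr
    _ = 2 * (1 + τ.real univ) * y ^ 2 := by ring

theorem integral_inv_ofReal_sub (τ : Measure ℝ) (z : ℂ) :
    ∫ x : ℝ, ((x : ℂ) - z)⁻¹ ∂τ = -cauchyTransform τ z := by
  rw [cauchyTransform, ← integral_neg]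
  congr 1 with x
  rw [← inv_neg, neg_sub]

/-- A probability measure on ℝ has compact support, mean 0 and variance σ² iff its
F-transform has the form `z + ∫ 1/(x-z) dτ(x)` for a compactly supported finite
nonnegative measure τ of total mass σ². -/
theorem Ftransform_compact_centered_characterization
    (μ : Measure ℝ) [IsProbabilityMeasure μ] (σ : ℝ) (hσ : 0 ≤ σ) :
    ((∃ K : Set ℝ, IsCompact K ∧ μ Kᶜ = 0) ∧
      (∫ x, x ∂μ) = 0 ∧
      (∫ x, x ^ 2 ∂μ) - (∫ x, x ∂μ) ^ 2 = σ ^ 2)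
    ↔ ∃ τ : Measure ℝ, IsFiniteMeasure τ ∧
        (∃ K : Set ℝ, IsCompact K ∧ τ Kᶜ = 0) ∧
        (τ Set.univ).toReal = σ ^ 2 ∧
        ∀ z : ℂ, 0 < z.im →
          Ftransform μ z = z + ∫ x, ((x : ℂ) - z)⁻¹ ∂τ := by
  simp only [integral_inv_ofReal_sub, ← sub_eq_add_neg]
  constructor
  · rintro ⟨hμ, hmean, hvar⟩
    obtain ⟨τ, hτ, hK, hmass, hF⟩ := exists_measure_Ftransform_eq μ hμ
    refine ⟨τ, hτ, hK, hmass.trans hvar, fun z hz ↦ ?_⟩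
    rw [hF z hz, hmean, Complex.ofReal_zero, sub_zero]
  · rintro ⟨τ, hτ, hK, hmass, hF⟩
    have hμ := exists_isCompact_of_Ftransform_eq μ τ hK hF
    obtain ⟨ρ, hρ, -, hmass', hF'⟩ := exists_measure_Ftransform_eq μ hμ
    have hsub : ∀ᶠ y : ℝ in atTop, cauchyTransform τ (y * Complex.I) -
        cauchyTransform ρ (y * Complex.I) = ((∫ x, x ∂μ : ℝ) : ℂ) := by
      filter_upwards [eventually_gt_atTop 0] with y hy
      have hz : 0 < ((y : ℂ) * Complex.I).im := by simpa using hy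
      linear_combination hF _ hz - hF' _ hz
    have hmean : (∫ x, x ∂μ) = 0 := by
      have h1 := (tendsto_cauchyTransform τ).sub (tendsto_cauchyTransform ρ)
      rw [sub_zero] at h1
      exact_mod_cast tendsto_nhds_unique
        (tendsto_const_nhds.congr' (hsub.mono fun y hy ↦ hy.symm)) h1
    refine ⟨hμ, hmean, ?_⟩
    rw [← hmass', ← hmass]
    refine Complex.ofReal_injective (tendsto_nhds_unique (tendsto_mul_cauchyTransform ρ) ?_)
    refine (tendsto_mul_cauchyTransform τ).congr' (hsub.mono fun y hy ↦ ?_)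
    rw [hmean, Complex.ofReal_zero, sub_eq_zero] at hy
    rw [hy]
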